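/- In the bt-algebra E_n(q), for all A ∈ SetPar_n and 1 ≤ a ≤ n−1: if a ∼_A (a+1) then g_a² ē(A) = (q + (q−1) g_a) ē(A), and if a ≁_A (a+1) then g_a² ē(A) = q ē(A). -/

import Mathlib

open scoped Classical

noncomputable section

namespace BT

/-- Generators of the bt-algebra (0-based indexing): `g a h` is the paper's `g_{a+1}`,
`e a h` is the paper's `e_{a+1}`. -/
inductive Gen (n : ℕ) : Type
  | g : (a : ℕ) → a + 1 < n → Gen n
  | e : (a : ℕ) → a + 1 < n → Gen n

variable (𝕜 : Type) [Field 𝕜] (n : ℕ) (q : 𝕜)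

abbrev F : Type := FreeAlgebra 𝕜 (Gen n)

def G (a : ℕ) (h : a + 1 < n) : F 𝕜 n := FreeAlgebra.ι 𝕜 (Gen.g a h)

def Eg (a : ℕ) (h : a + 1 < n) : F 𝕜 n := FreeAlgebra.ι 𝕜 (Gen.e a h)

/-- The defining relations of the bt-algebra `E_n(q)`. -/
inductive Rel : F 𝕜 n → F 𝕜 n → Prop
  | ge (a : ℕ) (h : a + 1 < n) :
      Rel (G 𝕜 n a h * Eg 𝕜 n a h) (Eg 𝕜 n a h * G 𝕜 n a h)
  | braid (a : ℕ) (h : a + 2 < n) :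
      Rel (G 𝕜 n a (by omega) * G 𝕜 n (a + 1) h * G 𝕜 n a (by omega))
        (G 𝕜 n (a + 1) h * G 𝕜 n a (by omega) * G 𝕜 n (a + 1) h)
  | gfar (a b : ℕ) (ha : a + 1 < n) (hb : b + 1 < n) (hab : a + 1 < b) :
      Rel (G 𝕜 n a ha * G 𝕜 n b hb) (G 𝕜 n b hb * G 𝕜 n a ha)
  | egg (a b : ℕ) (ha : a + 1 < n) (hb : b + 1 < n) (hab : b = a + 1 ∨ a = b + 1) :
      Rel (Eg 𝕜 n a ha * G 𝕜 n b hb * G 𝕜 n a ha)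
        (G 𝕜 n b hb * G 𝕜 n a ha * Eg 𝕜 n b hb)
  | eeg1 (a b : ℕ) (ha : a + 1 < n) (hb : b + 1 < n) (hab : b = a + 1 ∨ a = b + 1) :
      Rel (Eg 𝕜 n a ha * Eg 𝕜 n b hb * G 𝕜 n b hb)
        (Eg 𝕜 n a ha * G 𝕜 n b hb * Eg 𝕜 n a ha)
  | eeg2 (a b : ℕ) (ha : a + 1 < n) (hb : b + 1 < n) (hab : b = a + 1 ∨ a = b + 1) :
      Rel (Eg 𝕜 n a ha * G 𝕜 n b hb * Eg 𝕜 n a ha)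
        (G 𝕜 n b hb * Eg 𝕜 n a ha * Eg 𝕜 n b hb)
  | ee (a b : ℕ) (ha : a + 1 < n) (hb : b + 1 < n) :
      Rel (Eg 𝕜 n a ha * Eg 𝕜 n b hb) (Eg 𝕜 n b hb * Eg 𝕜 n a ha)
  | gefar (a b : ℕ) (ha : a + 1 < n) (hb : b + 1 < n) (hab : a + 1 < b ∨ b + 1 < a) :
      Rel (G 𝕜 n a ha * Eg 𝕜 n b hb) (Eg 𝕜 n b hb * G 𝕜 n a ha)
  | esq (a : ℕ) (ha : a + 1 < n) :
      Rel (Eg 𝕜 n a ha * Eg 𝕜 n a ha) (Eg 𝕜 n a ha)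
  | gsq (a : ℕ) (ha : a + 1 < n) :
      Rel (G 𝕜 n a ha ^ 2)
        (algebraMap 𝕜 (F 𝕜 n) q + (q - 1) • (Eg 𝕜 n a ha * G 𝕜 n a ha))

/-- The bt-algebra `E_n(q)`. -/
abbrev B : Type := RingQuot (Rel 𝕜 n q)

def π : F 𝕜 n →ₐ[𝕜] B 𝕜 n q := RingQuot.mkAlgHom 𝕜 (Rel 𝕜 n q)

def g (a : ℕ) (h : a + 1 < n) : B 𝕜 n q := π 𝕜 n q (G 𝕜 n a h)

def e (a : ℕ) (h : a + 1 < n) : B 𝕜 n q := π 𝕜 n q (Eg 𝕜 n a h)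

/-- The simple transposition `σ_a = (a, a+1)` (0-based). -/
def sw (a : ℕ) (h : a + 1 < n) : Equiv.Perm (Fin n) :=
  Equiv.swap ⟨a, by omega⟩ ⟨a + 1, h⟩

/-- `g_a` if the index is in range, else `1`. -/
def gTot (a : ℕ) : B 𝕜 n q := if h : a + 1 < n then g 𝕜 n q a h else 1

/-- `e_a` if the index is in range, else `1`. -/
def eTot (a : ℕ) : B 𝕜 n q := if h : a + 1 < n then e 𝕜 n q a h else 1

/-- `g_a⁻¹ = q⁻¹ g_a + (q⁻¹ − 1) e_a` if the index is in range, else `1`. -/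
def ginvTot (a : ℕ) : B 𝕜 n q :=
  if h : a + 1 < n then q⁻¹ • g 𝕜 n q a h + (q⁻¹ - 1) • e 𝕜 n q a h else 1

/-- `e_{ab} = g_{b-1} ⋯ g_{a+1} e_a g_{a+1}⁻¹ ⋯ g_{b-1}⁻¹` for `a < b` (0-based). -/
def eabN (a b : ℕ) : B 𝕜 n q :=
  ((((List.range (b - 1 - a)).map (fun i => a + 1 + i)).reverse).map (gTot 𝕜 n q)).prod
    * eTot 𝕜 n q a
    * (((List.range (b - 1 - a)).map (fun i => a + 1 + i)).map (ginvTot 𝕜 n q)).prod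

/-- `e_{ab}`, symmetrized so that `e_{ba} = e_{ab}`. -/
def eab (a b : Fin n) : B 𝕜 n q :=
  if (a : ℕ) ≤ (b : ℕ) then eabN 𝕜 n q a b else eabN 𝕜 n q b a

/-- `e(A) = ∏_{a ∼_A b, a ≠ b} e_{ab}` (the factors commute, so the product may be taken
in any fixed order). -/
def eSet (A : Setoid (Fin n)) : B 𝕜 n q :=
  (((List.finRange n) ×ˢ (List.finRange n)).map
    (fun p => if A.r p.1 p.2 ∧ p.1 ≠ p.2 then eab 𝕜 n q p.1 p.2 else 1)).prod

/-- The number of blocks of a set partition. -/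
def nblocks (A : Setoid (Fin n)) : ℕ := Nat.card (Quotient A)

/-- The number of blocks of `A` contained in the block `c` of `B` (when `A ≤ B`). -/
def mcount (A B : Setoid (Fin n)) (c : Quotient B) : ℕ :=
  Nat.card {dA : Quotient A // B.r dA.out c.out}

/-- The Möbius function of the poset `(SetPar_n, ⊆)`:
`μ(A,B) = (−1)^{r−s} ∏_{i=1}^{r−1} (i!)^{r_{i+1}}` if `A ⊆ B` and `0` otherwise, where `r, s`
are the numbers of blocks of `A, B` and `r_i` is the number of blocks of `B` containing
exactly `i` blocks of `A`. -/
def mob (A B : Setoid (Fin n)) : ℤ :=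
  if A ≤ B then
    (-1 : ℤ) ^ (nblocks n A - nblocks n B) *
      ∏ i ∈ Finset.Icc 1 (nblocks n A - 1),
        (Nat.factorial i : ℤ) ^ (Nat.card {c : Quotient B // mcount n A B c = i + 1})
  else 0

instance : Finite (Setoid (Fin n)) :=
  Finite.of_injective (fun A : Setoid (Fin n) => A.r)
    (fun A B h => by cases A; cases B; simp only at h; subst h; rfl)

noncomputable instance : Fintype (Setoid (Fin n)) := Fintype.ofFinite _

/-- `ē(A) = Σ_{B ⊇ A} μ(A,B) e(B)`. -/
def ebar (A : Setoid (Fin n)) : B 𝕜 n q :=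
  ∑ C ∈ Finset.univ.filter (fun C : Setoid (Fin n) => A ≤ C),
    mob n A C • eSet 𝕜 n q C

/-- The action of a permutation on set partitions. -/
def permSetoid (σ : Equiv.Perm (Fin n)) (A : Setoid (Fin n)) : Setoid (Fin n) where
  r x y := A.r (σ.symm x) (σ.symm y)
  iseqv := ⟨fun _ => A.iseqv.refl _, fun h => A.iseqv.symm h, fun h h' => A.iseqv.trans h h'⟩

section Relations

variable {𝕜 : Type} [Field 𝕜] {n : ℕ} {q : 𝕜}

lemma π_eq_of_rel {x y : F 𝕜 n} (h : Rel 𝕜 n q x y) : π 𝕜 n q x = π 𝕜 n q y :=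
  RingQuot.mkAlgHom_rel 𝕜 h

lemma g_mul_e (a : ℕ) (h : a + 1 < n) :
    g 𝕜 n q a h * e 𝕜 n q a h = e 𝕜 n q a h * g 𝕜 n q a h := by
  simpa [g, e] using π_eq_of_rel (q := q) (Rel.ge (𝕜 := 𝕜) a h)

lemma g_braid (a : ℕ) (h : a + 2 < n) :
    g 𝕜 n q a (by omega) * g 𝕜 n q (a + 1) h * g 𝕜 n q a (by omega)
      = g 𝕜 n q (a + 1) h * g 𝕜 n q a (by omega) * g 𝕜 n q (a + 1) h := by
  simpa [g, e] using π_eq_of_rel (q := q) (Rel.braid (𝕜 := 𝕜) a h)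

lemma commute_g_g {a b : ℕ} (ha : a + 1 < n) (hb : b + 1 < n) (hab : a + 1 < b ∨ b + 1 < a) :
    Commute (g 𝕜 n q a ha) (g 𝕜 n q b hb) := by
  rcases hab with hab | hab
  · simpa [g, e, commute_iff_eq] using π_eq_of_rel (q := q) (Rel.gfar (𝕜 := 𝕜) a b ha hb hab)
  · refine Commute.symm ?_
    simpa [g, e, commute_iff_eq] using π_eq_of_rel (q := q) (Rel.gfar (𝕜 := 𝕜) b a hb ha hab)

lemma e_mul_g_mul_g {a b : ℕ} (ha : a + 1 < n) (hb : b + 1 < n) (hab : b = a + 1 ∨ a = b + 1) :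
    e 𝕜 n q a ha * g 𝕜 n q b hb * g 𝕜 n q a ha
      = g 𝕜 n q b hb * g 𝕜 n q a ha * e 𝕜 n q b hb := by
  simpa [g, e] using π_eq_of_rel (q := q) (Rel.egg (𝕜 := 𝕜) a b ha hb hab)

lemma e_mul_e_mul_g {a b : ℕ} (ha : a + 1 < n) (hb : b + 1 < n) (hab : b = a + 1 ∨ a = b + 1) :
    e 𝕜 n q a ha * e 𝕜 n q b hb * g 𝕜 n q b hb
      = e 𝕜 n q a ha * g 𝕜 n q b hb * e 𝕜 n q a ha := by
  simpa [g, e] using π_eq_of_rel (q := q) (Rel.eeg1 (𝕜 := 𝕜) a b ha hb hab)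

lemma e_mul_g_mul_e {a b : ℕ} (ha : a + 1 < n) (hb : b + 1 < n) (hab : b = a + 1 ∨ a = b + 1) :
    e 𝕜 n q a ha * g 𝕜 n q b hb * e 𝕜 n q a ha
      = g 𝕜 n q b hb * e 𝕜 n q a ha * e 𝕜 n q b hb := by
  simpa [g, e] using π_eq_of_rel (q := q) (Rel.eeg2 (𝕜 := 𝕜) a b ha hb hab)

lemma commute_e_e {a b : ℕ} (ha : a + 1 < n) (hb : b + 1 < n) :
    Commute (e 𝕜 n q a ha) (e 𝕜 n q b hb) := by
  simpa [g, e, commute_iff_eq] using π_eq_of_rel (q := q) (Rel.ee (𝕜 := 𝕜) a b ha hb)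

lemma commute_g_e {a b : ℕ} (ha : a + 1 < n) (hb : b + 1 < n) (hab : a + 1 < b ∨ b + 1 < a) :
    Commute (g 𝕜 n q a ha) (e 𝕜 n q b hb) := by
  simpa [g, e, commute_iff_eq] using π_eq_of_rel (q := q) (Rel.gefar (𝕜 := 𝕜) a b ha hb hab)

lemma e_mul_self (a : ℕ) (ha : a + 1 < n) :
    e 𝕜 n q a ha * e 𝕜 n q a ha = e 𝕜 n q a ha := by
  simpa [g, e] using π_eq_of_rel (q := q) (Rel.esq (𝕜 := 𝕜) a ha)

lemma g_sq (a : ℕ) (ha : a + 1 < n) :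
    g 𝕜 n q a ha ^ 2
      = algebraMap 𝕜 (B 𝕜 n q) q + (q - 1) • (e 𝕜 n q a ha * g 𝕜 n q a ha) := by
  simpa [g, e, -algebraMap_smul] using π_eq_of_rel (q := q) (Rel.gsq (𝕜 := 𝕜) a ha)

lemma g_mul_ginv (hq : q ≠ 0) (a : ℕ) (ha : a + 1 < n) :
    g 𝕜 n q a ha * (q⁻¹ • g 𝕜 n q a ha + (q⁻¹ - 1) • e 𝕜 n q a ha) = 1 := by
  rw [mul_add, mul_smul_comm, mul_smul_comm, ← sq, g_sq, g_mul_e, smul_add, smul_smul,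
    Algebra.algebraMap_eq_smul_one, smul_smul, inv_mul_cancel₀ hq, one_smul, add_assoc, ← add_smul]
  have : q⁻¹ * (q - 1) + (q⁻¹ - 1) = 0 := by field_simp; ring
  rw [this, zero_smul, add_zero]

lemma ginv_mul_g (hq : q ≠ 0) (a : ℕ) (ha : a + 1 < n) :
    (q⁻¹ • g 𝕜 n q a ha + (q⁻¹ - 1) • e 𝕜 n q a ha) * g 𝕜 n q a ha = 1 := by
  rw [← g_mul_ginv hq a ha, add_mul, mul_add, smul_mul_assoc, smul_mul_assoc, mul_smul_comm,
    mul_smul_comm, g_mul_e]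

variable (n) in
/-- The generator `g_a` as a unit of the bt-algebra (`1` if the index is out of range). -/
def gUnit (hq : q ≠ 0) (a : ℕ) : (B 𝕜 n q)ˣ where
  val := gTot 𝕜 n q a
  inv := ginvTot 𝕜 n q a
  val_inv := by
    unfold gTot ginvTot
    split_ifs with h
    · exact g_mul_ginv hq a h
    · exact one_mul 1
  inv_val := by
    unfold gTot ginvTot
    split_ifs with h
    · exact ginv_mul_g hq a h
    · exact one_mul 1

lemma gUnit_val (hq : q ≠ 0) {a : ℕ} (h : a + 1 < n) :
    (gUnit n hq a : B 𝕜 n q) = g 𝕜 n q a h := by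
  simp [gUnit, gTot, h]

lemma eTot_eq {a : ℕ} (h : a + 1 < n) : eTot 𝕜 n q a = e 𝕜 n q a h := by
  simp [eTot, h]

lemma eabN_succ_self (a : ℕ) : eabN 𝕜 n q a (a + 1) = eTot 𝕜 n q a := by
  simp [eabN]

lemma eabN_succ (hq : q ≠ 0) {a b : ℕ} (hab : a < b) :
    eabN 𝕜 n q a (b + 1)
      = gUnit n hq b * eabN 𝕜 n q a b * ((gUnit n hq b)⁻¹ : (B 𝕜 n q)ˣ) := by
  obtain ⟨m, rfl⟩ := Nat.exists_eq_add_of_lt hab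
  have h1 : a + m + 1 + 1 - 1 - a = m + 1 := by omega
  have h2 : a + m + 1 - 1 - a = m := by omega
  have h3 : a + 1 + m = a + m + 1 := by omega
  simp only [eabN, h1, h2, List.range_succ]
  simp [h3, gUnit, mul_assoc]

end Relations

section Conjugation

variable {𝕜 : Type} [Field 𝕜] {n : ℕ} {q : 𝕜}

lemma semiconjBy_eabN_succ (hq : q ≠ 0) {i j : ℕ} (hij : i < j) :
    SemiconjBy (gUnit n hq j : B 𝕜 n q) (eabN 𝕜 n q i j) (eabN 𝕜 n q i (j + 1)) := by
  rw [eabN_succ hq hij]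
  exact Units.mk_semiconjBy _ _

/-- Conjugating both sides of a semiconjugation by elements commuting with the conjugator. -/
lemma _root_.SemiconjBy.conj_of_commute {M : Type*} [Monoid M] {u v : Mˣ} {x y x' y' : M}
    (h : SemiconjBy (u : M) x y) (hc : Commute (u : M) v)
    (hx : SemiconjBy (v : M) x x') (hy : SemiconjBy (v : M) y y') :
    SemiconjBy (u : M) x' y' := by
  have h1 : SemiconjBy ((v : M) * (u * ((v⁻¹ : Mˣ) : M))) x' y' :=
    hy.mul_left (h.mul_left hx.units_inv_symm_left)
  rwa [← mul_assoc, ← hc.eq, mul_assoc, Units.mul_inv, mul_one] at h1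

lemma commute_gUnit_gUnit (hq : q ≠ 0) {a b : ℕ} (ha : a + 1 < n) (hb : b + 1 < n)
    (hab : a + 1 < b ∨ b + 1 < a) :
    Commute (gUnit n hq a : B 𝕜 n q) (gUnit n hq b) := by
  rw [gUnit_val hq ha, gUnit_val hq hb]
  exact commute_g_g ha hb hab

/-- For neighbouring indices `g_b²` commutes with `e_a`. -/
lemma g_mul_g_mul_e {a b : ℕ} (ha : a + 1 < n) (hb : b + 1 < n) (hab : b = a + 1 ∨ a = b + 1) :
    g 𝕜 n q b hb * g 𝕜 n q b hb * e 𝕜 n q a ha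
      = e 𝕜 n q a ha * (g 𝕜 n q b hb * g 𝕜 n q b hb) := by
  rw [← sq, g_sq, add_mul, mul_add, smul_mul_assoc, mul_smul_comm, ← mul_assoc (e _ _ _ _ _),
    e_mul_e_mul_g ha hb hab, e_mul_g_mul_e ha hb hab, ← g_mul_e, mul_assoc,
    (commute_e_e hb ha).eq, mul_assoc, Algebra.commutes]

lemma semiconjBy_eabN_pred_top (hq : q ≠ 0) {i j : ℕ} (hij : i + 1 < j) (hj : j < n) :
    SemiconjBy (gUnit n hq i : B 𝕜 n q) (eabN 𝕜 n q (i + 1) j) (eabN 𝕜 n q i j)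
      ∧ SemiconjBy (gUnit n hq i : B 𝕜 n q) (eabN 𝕜 n q i j) (eabN 𝕜 n q (i + 1) j) := by
  induction j, hij using Nat.le_induction with
  | base =>
    have hi : i + 1 < n := by omega
    have h0 : SemiconjBy (gUnit n hq (i + 1) : B 𝕜 n q) (eabN 𝕜 n q i (i + 1))
      (eabN 𝕜 n q i (i + 2)) := semiconjBy_eabN_succ hq (by omega)
    have h0' : SemiconjBy (gUnit n hq (i + 1) : B 𝕜 n q) (eabN 𝕜 n q i (i + 2))
        (eabN 𝕜 n q i (i + 1)) := by
      have h := eabN_succ (𝕜 := 𝕜) (n := n) hq (Nat.lt_succ_self i)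
      rw [Nat.succ_eq_add_one] at h
      rw [SemiconjBy, h, eabN_succ_self, eTot_eq hi, ← mul_assoc, ← mul_assoc,
        Units.mul_inv_eq_iff_eq_mul, gUnit_val hq hj,
        g_mul_g_mul_e hi hj (Or.inl rfl), mul_assoc]
    have e1 := e_mul_g_mul_g (𝕜 := 𝕜) (q := q) hi hj (Or.inl rfl)
    have e2 := e_mul_g_mul_g (𝕜 := 𝕜) (q := q) hj hi (Or.inr rfl)
    rw [← gUnit_val hq hi, ← gUnit_val hq hj, ← eTot_eq hi, ← eTot_eq hj,
      ← eabN_succ_self, ← eabN_succ_self] at e1 e2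
    constructor
    · have h1 : SemiconjBy ((gUnit n hq (i + 1) : B 𝕜 n q) * gUnit n hq i)
        (eabN 𝕜 n q (i + 1) (i + 2)) (eabN 𝕜 n q i (i + 1)) := by
        rw [SemiconjBy, ← mul_assoc]; exact e1.symm
      have h2 := h0'.units_inv_symm_left.mul_left h1
      rwa [← mul_assoc, Units.inv_mul, one_mul] at h2
    · have h1 : SemiconjBy ((gUnit n hq i : B 𝕜 n q) * gUnit n hq (i + 1))
        (eabN 𝕜 n q i (i + 1)) (eabN 𝕜 n q (i + 1) (i + 2)) := by
        rw [SemiconjBy, ← mul_assoc]; exact e2.symm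
      have h2 := h1.mul_left h0.units_inv_symm_left
      rwa [mul_assoc, Units.mul_inv, mul_one] at h2
  | succ j hij ih =>
    obtain ⟨ih1, ih2⟩ := ih (by omega)
    have hc := commute_gUnit_gUnit (𝕜 := 𝕜) (n := n) hq (a := i) (b := j) (by omega) (by omega)
      (Or.inl (by omega))
    exact ⟨ih1.conj_of_commute hc (semiconjBy_eabN_succ hq (by omega))
        (semiconjBy_eabN_succ hq (by omega)),
      ih2.conj_of_commute hc (semiconjBy_eabN_succ hq (by omega))
        (semiconjBy_eabN_succ hq (by omega))⟩

lemma semiconjBy_eabN_pred (hq : q ≠ 0) {i j : ℕ} (hij : i < j) (hj : j + 1 < n) :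
    SemiconjBy (gUnit n hq j : B 𝕜 n q) (eabN 𝕜 n q i (j + 1)) (eabN 𝕜 n q i j) := by
  obtain ⟨m, rfl⟩ := Nat.exists_eq_add_of_lt hij
  clear hij
  induction m generalizing i with
  | zero =>
    have hi : i + 1 < n := by omega
    rw [add_zero, SemiconjBy, eabN_succ (𝕜 := 𝕜) (n := n) hq (Nat.lt_succ_self i), eabN_succ_self,
      eTot_eq hi, ← mul_assoc, ← mul_assoc, Units.mul_inv_eq_iff_eq_mul,
      gUnit_val hq hj, g_mul_g_mul_e hi hj (Or.inl rfl), mul_assoc]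
  | succ m ih =>
    have h := ih (i := i + 1) (by omega)
    have e1 : i + 1 + m + 1 = i + (m + 1) + 1 := by omega
    rw [e1] at h
    exact h.conj_of_commute (commute_gUnit_gUnit hq (by omega) (by omega) (Or.inr (by omega)))
      (semiconjBy_eabN_pred_top hq (by omega) (by omega)).1
      (semiconjBy_eabN_pred_top hq (by omega) (by omega)).1

lemma commute_gUnit_eabN_of_far (hq : q ≠ 0) {a i j : ℕ} (ha : a + 1 < n) (hij : i < j)
    (hj : j < n) (h : a + 1 < i ∨ j < a) :
    Commute (gUnit n hq a : B 𝕜 n q) (eabN 𝕜 n q i j) := by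
  induction j, hij using Nat.le_induction with
  | base =>
    rw [Nat.succ_eq_add_one, eabN_succ_self, eTot_eq hj, gUnit_val hq ha]
    exact commute_g_e ha hj (by omega)
  | succ j hij ih =>
    have h1 : SemiconjBy (gUnit n hq a : B 𝕜 n q) _ _ := ih (by omega) (by omega)
    exact h1.conj_of_commute (commute_gUnit_gUnit hq ha hj (by omega))
      (semiconjBy_eabN_succ hq (by omega)) (semiconjBy_eabN_succ hq (by omega))

lemma commute_gUnit_eabN_of_between (hq : q ≠ 0) {a i j : ℕ} (hia : i < a) (haj : a + 1 < j)
    (hj : j < n) : Commute (gUnit n hq a : B 𝕜 n q) (eabN 𝕜 n q i j) := by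
  induction j, haj using Nat.le_induction with
  | base =>
    have ha : a + 1 < n := by omega
    have h0 : SemiconjBy (gUnit n hq (a + 1) : B 𝕜 n q) (eabN 𝕜 n q i a) (eabN 𝕜 n q i a) :=
      commute_gUnit_eabN_of_far hq hj hia (by omega) (by omega)
    have h1 : SemiconjBy (gUnit n hq a : B 𝕜 n q) (eabN 𝕜 n q i a) (eabN 𝕜 n q i (a + 1)) :=
      semiconjBy_eabN_succ hq hia
    have h2 : SemiconjBy (gUnit n hq (a + 1) : B 𝕜 n q) (eabN 𝕜 n q i (a + 1))
        (eabN 𝕜 n q i (a + 2)) := semiconjBy_eabN_succ hq (by omega)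
    have h4 : SemiconjBy ((gUnit n hq (a + 1) * gUnit n hq a : (B 𝕜 n q)ˣ) : B 𝕜 n q)
        (eabN 𝕜 n q i a) (eabN 𝕜 n q i (a + 2)) := h2.mul_left h1
    have h5 := (h4.mul_left h0).mul_left h4.units_inv_symm_left
    have hb : (gUnit n hq (a + 1) : B 𝕜 n q) * gUnit n hq a * gUnit n hq (a + 1)
        = gUnit n hq a * (gUnit n hq (a + 1) * gUnit n hq a) := by
      rw [gUnit_val hq ha, gUnit_val hq hj, ← g_braid a hj, mul_assoc]
    rw [Units.val_mul, hb, ← Units.val_mul, mul_assoc, Units.mul_inv, mul_one] at h5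
    exact h5
  | succ j haj ih =>
    have h1 : SemiconjBy (gUnit n hq a : B 𝕜 n q) _ _ := ih (by omega)
    exact h1.conj_of_commute (commute_gUnit_gUnit hq (by omega) hj (by omega))
      (semiconjBy_eabN_succ hq (by omega)) (semiconjBy_eabN_succ hq (by omega))

end Conjugation

section Ties

variable {𝕜 : Type} [Field 𝕜] {n : ℕ} {q : 𝕜}

lemma eab_of_lt {i j : Fin n} (h : i < j) : eab 𝕜 n q i j = eabN 𝕜 n q i j :=
  if_pos (Fin.lt_def.1 h).le

lemma eab_comm (i j : Fin n) : eab 𝕜 n q i j = eab 𝕜 n q j i := by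
  rcases lt_trichotomy i j with h | rfl | h
  · rw [eab_of_lt h, eab, if_neg (by simpa using h)]
  · rfl
  · rw [eab_of_lt h, eab, if_neg (by simpa using h)]

lemma eab_succ {a : ℕ} (h : a + 1 < n) :
    eab 𝕜 n q ⟨a, by omega⟩ ⟨a + 1, h⟩ = e 𝕜 n q a h := by
  rw [eab_of_lt (by simp), eabN_succ_self, eTot_eq h]

lemma semiconjBy_eab_sw (hq : q ≠ 0) {a : ℕ} (h : a + 1 < n) {i j : Fin n} (hij : i ≠ j) :
    SemiconjBy (gUnit n hq a : B 𝕜 n q) (eab 𝕜 n q i j)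
      (eab 𝕜 n q (sw n a h i) (sw n a h j)) := by
  wlog hlt : i < j generalizing i j
  · rw [eab_comm, eab_comm (sw n a h i)]
    exact this hij.symm (lt_of_le_of_ne (not_lt.1 hlt) hij.symm)
  obtain ⟨i, hi⟩ := i
  obtain ⟨j, hj⟩ := j
  rw [Fin.mk_lt_mk] at hlt
  rw [eab_of_lt (Fin.mk_lt_mk.2 hlt)]
  rcases eq_or_ne i a with rfl | hia
  · rw [sw, Equiv.swap_apply_left]
    rcases eq_or_ne j (i + 1) with rfl | hja
    · rw [Equiv.swap_apply_right, eab_comm, eab_succ, eabN_succ_self, eTot_eq hj, gUnit_val hq hj]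
      exact g_mul_e i hj
    · rw [Equiv.swap_apply_of_ne_of_ne (by simpa using hlt.ne') (by simpa using hja),
        eab_of_lt (Fin.mk_lt_mk.2 (by omega))]
      exact (semiconjBy_eabN_pred_top hq (by omega) hj).2
  rcases eq_or_ne i (a + 1) with rfl | hia'
  · rw [sw, Equiv.swap_apply_right, Equiv.swap_apply_of_ne_of_ne (by simp; omega)
      (by simpa using hlt.ne'), eab_of_lt (Fin.mk_lt_mk.2 (by omega))]
    exact (semiconjBy_eabN_pred_top hq (by omega) hj).1
  have hi' : sw n a h ⟨i, hi⟩ = ⟨i, hi⟩ :=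
    Equiv.swap_apply_of_ne_of_ne (by simpa using hia) (by simpa using hia')
  rw [hi', sw]
  rcases eq_or_ne j a with rfl | hja
  · rw [Equiv.swap_apply_left, eab_of_lt (Fin.mk_lt_mk.2 (by omega))]
    exact semiconjBy_eabN_succ hq hlt
  rcases eq_or_ne j (a + 1) with rfl | hja'
  · rw [Equiv.swap_apply_right, eab_of_lt (Fin.mk_lt_mk.2 (by omega))]
    exact semiconjBy_eabN_pred hq (show i < a by omega) h
  rw [Equiv.swap_apply_of_ne_of_ne (by simpa using hja) (by simpa using hja'),
    eab_of_lt (Fin.mk_lt_mk.2 hlt)]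
  by_cases hfar : a + 1 < i ∨ j < a
  · exact commute_gUnit_eabN_of_far hq h hlt hj hfar
  · exact commute_gUnit_eabN_of_between hq (show i < a by omega) (show a + 1 < j by omega) hj

lemma exists_unit_semiconjBy_eab (hq : q ≠ 0) (σ : Equiv.Perm (Fin n)) :
    ∃ u : (B 𝕜 n q)ˣ, ∀ i j : Fin n, i ≠ j →
      SemiconjBy (u : B 𝕜 n q) (eab 𝕜 n q i j) (eab 𝕜 n q (σ i) (σ j)) := by
  cases n with
  | zero => exact ⟨1, fun i => i.elim0⟩
  | succ m =>
    have hσ : σ ∈ Submonoid.closure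
        (Set.range fun i : Fin m => Equiv.swap i.castSucc i.succ) := by
      rw [Equiv.Perm.mclosure_swap_castSucc_succ]
      trivial
    induction hσ using Submonoid.closure_induction with
    | mem σ hσ =>
      obtain ⟨i, rfl⟩ := hσ
      exact ⟨gUnit (m + 1) hq i, fun _ _ hij =>
        semiconjBy_eab_sw hq (Nat.succ_lt_succ i.isLt) hij⟩
    | one => exact ⟨1, fun i j _ => SemiconjBy.one_left _⟩
    | mul σ τ _ _ hσ hτ =>
      obtain ⟨u, hu⟩ := hσ
      obtain ⟨v, hv⟩ := hτ
      exact ⟨u * v, fun i j hij => (hu _ _ (τ.injective.ne hij)).mul_left (hv i j hij)⟩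

/-- Any tuple of distinct indices can be moved to `0, 1, …, k - 1` by conjugation. -/
lemma exists_unit_semiconjBy_castLE (hq : q ≠ 0) {k : ℕ} {f : Fin k → Fin n}
    (hf : Function.Injective f) :
    ∃ (hk : k ≤ n) (u : (B 𝕜 n q)ˣ), ∀ i j : Fin k, i ≠ j →
      SemiconjBy (u : B 𝕜 n q) (eab 𝕜 n q (Fin.castLE hk i) (Fin.castLE hk j))
        (eab 𝕜 n q (f i) (f j)) := by
  have hk : k ≤ n := by simpa using Fintype.card_le_of_injective f hf
  obtain ⟨σ, hσ⟩ := Equiv.Perm.exists_extending_pair (Fin.castLE hk) f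
    (Fin.castLE_injective hk) hf
  obtain ⟨u, hu⟩ := exists_unit_semiconjBy_eab (𝕜 := 𝕜) hq σ
  refine ⟨hk, u, fun i j hij => ?_⟩
  rw [← hσ i, ← hσ j]
  exact hu _ _ ((Fin.castLE_injective hk).ne hij)

lemma _root_.SemiconjBy.eq_of_unit {M : Type*} [Monoid M] {u : Mˣ} {x x' y : M}
    (h : SemiconjBy (u : M) y x) (h' : SemiconjBy (u : M) y x') : x = x' :=
  u.isUnit.mul_left_injective (h.eq.symm.trans h'.eq)

lemma eab_mul_self (hq : q ≠ 0) {i j : Fin n} (hij : i ≠ j) :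
    eab 𝕜 n q i j * eab 𝕜 n q i j = eab 𝕜 n q i j := by
  obtain ⟨hk, u, hu⟩ := exists_unit_semiconjBy_castLE (𝕜 := 𝕜) hq (f := ![i, j])
    (by intro x y; fin_cases x <;> fin_cases y <;> simp_all [eq_comm])
  have h := hu 0 1 (by decide)
  refine (h.mul_right h).eq_of_unit ?_
  have h0 : eab 𝕜 n q (Fin.castLE hk 0) (Fin.castLE hk 1) = _ := eab_succ (a := 0) (by omega)
  rw [h0, e_mul_self, ← h0]
  exact h

lemma commute_eab_of_common (hq : q ≠ 0) {i j k : Fin n} (hij : i ≠ j) (hjk : j ≠ k)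
    (hik : i ≠ k) : Commute (eab 𝕜 n q i j) (eab 𝕜 n q j k) := by
  obtain ⟨hk, u, hu⟩ := exists_unit_semiconjBy_castLE (𝕜 := 𝕜) hq (f := ![i, j, k])
    (by intro x y; fin_cases x <;> fin_cases y <;> simp_all [eq_comm])
  have h := hu 0 1 (by decide)
  have h' := hu 1 2 (by decide)
  refine (h.mul_right h').eq_of_unit ?_
  have h0 : eab 𝕜 n q (Fin.castLE hk 0) (Fin.castLE hk 1) = _ := eab_succ (a := 0) (by omega)
  have h1 : eab 𝕜 n q (Fin.castLE hk 1) (Fin.castLE hk 2) = _ := eab_succ (a := 1) (by omega)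
  rw [h0, h1, (commute_e_e _ _).eq, ← h0, ← h1]
  exact h'.mul_right h

lemma eab_mul_eab (hq : q ≠ 0) {i j k : Fin n} (hij : i ≠ j) (hjk : j ≠ k)
    (hik : i ≠ k) : eab 𝕜 n q i j * eab 𝕜 n q i k = eab 𝕜 n q i j * eab 𝕜 n q j k := by
  obtain ⟨hk, u, hu⟩ := exists_unit_semiconjBy_castLE (𝕜 := 𝕜) hq (f := ![i, j, k])
    (by intro x y; fin_cases x <;> fin_cases y <;> simp_all [eq_comm])
  have h := hu 0 1 (by decide)
  have h' := hu 1 2 (by decide)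
  have h'' := hu 0 2 (by decide)
  refine (h.mul_right h'').eq_of_unit ?_
  have h0 : eab 𝕜 n q (Fin.castLE hk 0) (Fin.castLE hk 1) = _ := eab_succ (a := 0) (by omega)
  have h1 : eab 𝕜 n q (Fin.castLE hk 1) (Fin.castLE hk 2) = _ := eab_succ (a := 1) (by omega)
  have h2 : eab 𝕜 n q (Fin.castLE hk 0) (Fin.castLE hk 2)
      = gUnit n hq 1 * e 𝕜 n q 0 (by omega) * ((gUnit n hq 1)⁻¹ : (B 𝕜 n q)ˣ) := by
    rw [eab_of_lt (by simp [Fin.lt_def])]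
    have h3 := eabN_succ (𝕜 := 𝕜) (n := n) hq (a := 0) (b := 1) (by omega)
    rw [eabN_succ_self, eTot_eq (show 0 + 1 < n by omega)] at h3
    exact h3
  have h3 : eab 𝕜 n q (Fin.castLE hk 0) (Fin.castLE hk 1)
        * eab 𝕜 n q (Fin.castLE hk 0) (Fin.castLE hk 2)
      = eab 𝕜 n q (Fin.castLE hk 0) (Fin.castLE hk 1)
        * eab 𝕜 n q (Fin.castLE hk 1) (Fin.castLE hk 2) := by
    rw [h2, h0, h1, ← mul_assoc, ← mul_assoc, Units.mul_inv_eq_iff_eq_mul,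
      gUnit_val hq (show 1 + 1 < n by omega)]
    exact (e_mul_e_mul_g _ _ (Or.inl rfl)).symm
  rw [h3]
  exact h.mul_right h'

lemma commute_eab_eab (hq : q ≠ 0) {i j k l : Fin n} (hij : i ≠ j) (hkl : k ≠ l) :
    Commute (eab 𝕜 n q i j) (eab 𝕜 n q k l) := by
  have key : ∀ i j k : Fin n, i ≠ j → j ≠ k → Commute (eab 𝕜 n q i j) (eab 𝕜 n q j k) := by
    intro i j k hij hjk
    rcases eq_or_ne i k with rfl | hik
    · rw [eab_comm]
    · exact commute_eab_of_common hq hij hjk hik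
  rcases eq_or_ne j k with rfl | hjk
  · exact key i j l hij hkl
  rcases eq_or_ne j l with rfl | hjl
  · rw [eab_comm k]
    exact key i j k hij hkl.symm
  rcases eq_or_ne i k with rfl | hik
  · rw [eab_comm]
    exact key j i l hij.symm hkl
  rcases eq_or_ne i l with rfl | hil
  · rw [eab_comm, eab_comm k]
    exact key j i k hij.symm hkl.symm
  obtain ⟨hk, u, hu⟩ := exists_unit_semiconjBy_castLE (𝕜 := 𝕜) hq (f := ![i, j, k, l])
    (by intro x y; fin_cases x <;> fin_cases y <;> simp_all [eq_comm])
  have h := hu 0 1 (by decide)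
  have h' := hu 2 3 (by decide)
  refine (h.mul_right h').eq_of_unit ?_
  have h0 : eab 𝕜 n q (Fin.castLE hk 0) (Fin.castLE hk 1) = _ := eab_succ (a := 0) (by omega)
  have h1 : eab 𝕜 n q (Fin.castLE hk 2) (Fin.castLE hk 3) = _ := eab_succ (a := 2) (by omega)
  rw [h0, h1, (commute_e_e _ _).eq, ← h0, ← h1]
  exact h'.mul_right h

end Ties

section SetPartitions

/-- The finest coarsening of the setoid `C` that relates `a` and `b`. -/
def glue {X : Type*} (C : Setoid X) (a b : X) : Setoid X where
  r x y := C x y ∨ (C x a ∧ C b y) ∨ (C x b ∧ C a y)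
  iseqv :=
    { refl := fun x => Or.inl (C.refl' x)
      symm := by
        rintro x y (h | ⟨h, h'⟩ | ⟨h, h'⟩)
        · exact Or.inl (C.symm' h)
        · exact Or.inr (Or.inr ⟨C.symm' h', C.symm' h⟩)
        · exact Or.inr (Or.inl ⟨C.symm' h', C.symm' h⟩)
      trans := by
        rintro x y z (h | ⟨h, h'⟩ | ⟨h, h'⟩) (k | ⟨k, k'⟩ | ⟨k, k'⟩)
        · exact Or.inl (C.trans' h k)
        · exact Or.inr (Or.inl ⟨C.trans' h k, k'⟩)
        · exact Or.inr (Or.inr ⟨C.trans' h k, k'⟩)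
        · exact Or.inr (Or.inl ⟨h, C.trans' h' k⟩)
        · exact Or.inr (Or.inl ⟨h, k'⟩)
        · exact Or.inl (C.trans' h k')
        · exact Or.inr (Or.inr ⟨h, C.trans' h' k⟩)
        · exact Or.inl (C.trans' h k')
        · exact Or.inr (Or.inr ⟨h, k'⟩) }

lemma glue_rel {X : Type*} {C : Setoid X} {a b x y : X} :
    glue C a b x y ↔ C x y ∨ (C x a ∧ C b y) ∨ (C x b ∧ C a y) := Iff.rfl

lemma le_glue {X : Type*} (C : Setoid X) (a b : X) : C ≤ glue C a b := fun _ _ h => Or.inl h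

lemma glue_rel_left_right {X : Type*} (C : Setoid X) (a b : X) : glue C a b a b :=
  Or.inr (Or.inl ⟨C.refl' a, C.refl' b⟩)

lemma glue_le {X : Type*} {C D : Setoid X} {a b : X} (h : C ≤ D) (hab : D a b) :
    glue C a b ≤ D := by
  rintro x y (hxy | ⟨h1, h2⟩ | ⟨h1, h2⟩)
  · exact h hxy
  · exact D.trans' (h h1) (D.trans' hab (h h2))
  · exact D.trans' (h h1) (D.trans' (D.symm' hab) (h h2))

lemma glue_eq_self {X : Type*} {C : Setoid X} {a b : X} (hab : C a b) : glue C a b = C :=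
  le_antisymm (glue_le le_rfl hab) (le_glue C a b)

lemma _root_.List.mul_prod_map_of_mem {ι M : Type*} [Monoid M] {l : List ι} {f : ι → M} {p : ι}
    (hp : p ∈ l) (hc : ∀ r ∈ l, Commute (f p) (f r)) (hi : f p * f p = f p) :
    f p * (l.map f).prod = (l.map f).prod := by
  induction l with
  | nil => simp at hp
  | cons r l ih =>
    rw [List.map_cons, List.prod_cons]
    rcases List.mem_cons.1 hp with rfl | hp
    · rw [← mul_assoc, hi]
    · rw [← mul_assoc, (hc r List.mem_cons_self).eq, mul_assoc,
        ih hp fun s hs => hc s (List.mem_cons_of_mem r hs)]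

lemma _root_.List.prod_map_mul_eq {ι M : Type*} [Monoid M] {l : List ι} {f : ι → M} {z : M}
    (h : ∀ p ∈ l, f p * z = z) : (l.map f).prod * z = z := by
  induction l with
  | nil => simp
  | cons r l ih =>
    rw [List.map_cons, List.prod_cons, mul_assoc,
      ih fun p hp => h p (List.mem_cons_of_mem r hp), h r List.mem_cons_self]

variable {𝕜 : Type} [Field 𝕜] {n : ℕ} {q : 𝕜}

lemma commute_eab_eSet (hq : q ≠ 0) {i j : Fin n} (hij : i ≠ j) (C : Setoid (Fin n)) :
    Commute (eab 𝕜 n q i j) (eSet 𝕜 n q C) := by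
  refine Commute.list_prod_right _ _ fun x hx => ?_
  obtain ⟨p, -, rfl⟩ := List.mem_map.1 hx
  split_ifs with h
  · exact commute_eab_eab hq hij h.2
  · exact Commute.one_right _

lemma commute_eSet_eSet (hq : q ≠ 0) (C D : Setoid (Fin n)) :
    Commute (eSet 𝕜 n q C) (eSet 𝕜 n q D) := by
  refine Commute.list_prod_left _ _ fun x hx => ?_
  obtain ⟨p, -, rfl⟩ := List.mem_map.1 hx
  split_ifs with h
  · exact commute_eab_eSet hq h.2 D
  · exact Commute.one_left _

lemma eab_mul_eSet (hq : q ≠ 0) {i j : Fin n} (hij : i ≠ j) {C : Setoid (Fin n)} (h : C i j) :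
    eab 𝕜 n q i j * eSet 𝕜 n q C = eSet 𝕜 n q C := by
  have hp : C.r i j ∧ i ≠ j := ⟨h, hij⟩
  have key := List.mul_prod_map_of_mem (l := List.finRange n ×ˢ List.finRange n) (p := (i, j))
    (f := fun p => if C.r p.1 p.2 ∧ p.1 ≠ p.2 then eab 𝕜 n q p.1 p.2 else 1)
    (by simp) (fun r _ => by
      simp only [if_pos hp]
      split_ifs with h'
      · exact commute_eab_eab hq hij h'.2
      · exact Commute.one_right _)
    (by simp only [if_pos hp]; exact eab_mul_self hq hij)
  simp only [if_pos hp] at key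
  exact key

/-- The pairs of indices whose tie is absorbed by `z` form an equivalence relation. -/
def absorbed (hq : q ≠ 0) (z : B 𝕜 n q) : Setoid (Fin n) where
  r i j := i ≠ j → eab 𝕜 n q i j * z = z
  iseqv :=
    { refl := fun i hi => absurd rfl hi
      symm := fun h hji => by rw [eab_comm]; exact h hji.symm
      trans := by
        intro i j k hij hjk hik
        rcases eq_or_ne i j with rfl | h
        · exact hjk hik
        rcases eq_or_ne j k with rfl | h'
        · exact hij hik
        rw [← hij h, ← mul_assoc, (commute_eab_eab hq hik h).eq, eab_mul_eab hq h h' hik,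
          mul_assoc, hjk h', hij h] }

lemma eSet_mul_eq_of_le_absorbed (hq : q ≠ 0) {z : B 𝕜 n q} {C : Setoid (Fin n)}
    (h : C ≤ absorbed hq z) : eSet 𝕜 n q C * z = z := by
  refine List.prod_map_mul_eq fun p _ => ?_
  split_ifs with hp
  · exact h hp.1 hp.2
  · exact one_mul z

lemma eab_mul_eSet_eq_eSet_glue (hq : q ≠ 0) {i j : Fin n} (hij : i ≠ j) (C : Setoid (Fin n)) :
    eab 𝕜 n q i j * eSet 𝕜 n q C = eSet 𝕜 n q (glue C i j) := by
  have h1 : eSet 𝕜 n q (glue C i j) * (eab 𝕜 n q i j * eSet 𝕜 n q C)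
      = eab 𝕜 n q i j * eSet 𝕜 n q C := by
    refine eSet_mul_eq_of_le_absorbed hq (glue_le (fun x y h hxy => ?_) fun _ => ?_)
    · rw [← mul_assoc, (commute_eab_eab hq hxy hij).eq, mul_assoc, eab_mul_eSet hq hxy h]
    · rw [← mul_assoc, eab_mul_self hq hij]
  have h2 : eSet 𝕜 n q C * eSet 𝕜 n q (glue C i j) = eSet 𝕜 n q (glue C i j) :=
    eSet_mul_eq_of_le_absorbed hq fun x y h hxy => eab_mul_eSet hq hxy (le_glue C i j h)
  rw [← h1, ← mul_assoc, ← (commute_eab_eSet hq hij _).eq,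
    eab_mul_eSet hq hij (glue_rel_left_right C i j), ← (commute_eSet_eSet hq _ _).eq, h2]

end SetPartitions

section Moebius

/-- The Möbius number of the partition lattice of an `m`-element set. -/
def moebiusWeight (m : ℕ) : ℤ := (-1) ^ (m - 1) * (m - 1).factorial

lemma sum_choose_mul_moebiusWeight (m : ℕ) :
    ∑ j ∈ Finset.range (m + 1),
        (m.choose j : ℤ) * (moebiusWeight (j + 1) * moebiusWeight (m - j + 1))
      = -moebiusWeight (m + 2) := by
  have h : ∀ j ∈ Finset.range (m + 1),
      (m.choose j : ℤ) * (moebiusWeight (j + 1) * moebiusWeight (m - j + 1))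
        = (-1) ^ m * m.factorial := by
    intro j hj
    have hjm : j ≤ m := Nat.lt_succ_iff.1 (Finset.mem_range.1 hj)
    have h1 : ((m.choose j * j.factorial * (m - j).factorial : ℕ) : ℤ) = m.factorial := by
      rw [Nat.choose_mul_factorial_mul_factorial hjm]
    have h2 : (-1 : ℤ) ^ m = (-1) ^ j * (-1) ^ (m - j) := by
      rw [← pow_add, Nat.add_sub_cancel' hjm]
    rw [← h1, h2]
    simp only [moebiusWeight, Nat.add_sub_cancel]
    push_cast
    ring
  rw [Finset.sum_congr rfl h, Finset.sum_const, Finset.card_range, moebiusWeight,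
    show m + 2 - 1 = m + 1 by omega, Nat.factorial_succ, nsmul_eq_mul, pow_succ]
  push_cast
  ring

/-- Split every block of `D` into its parts inside and outside of `T`. -/
def split {X : Type*} (D : Setoid X) (T : Finset X) : Setoid X where
  r x y := D x y ∧ (x ∈ T ↔ y ∈ T)
  iseqv :=
    { refl := fun x => ⟨D.refl' x, Iff.rfl⟩
      symm := fun h => ⟨D.symm' h.1, h.2.symm⟩
      trans := fun h k => ⟨D.trans' h.1 k.1, h.2.trans k.2⟩ }

lemma split_rel {X : Type*} {D : Setoid X} {T : Finset X} {x y : X} :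
    split D T x y ↔ D x y ∧ (x ∈ T ↔ y ∈ T) := Iff.rfl

variable {X : Type*} [Fintype X]

/-- The block of `x` in the set partition `E`. -/
def block (E : Setoid X) (x : X) : Finset X := Finset.univ.filter fun y => E x y

lemma mem_block {E : Setoid X} {x y : X} : y ∈ block E x ↔ E x y := by simp [block]

lemma mem_block_self (E : Setoid X) (x : X) : x ∈ block E x := mem_block.2 (E.refl' x)

lemma block_eq_iff {E : Setoid X} {x y : X} : block E x = block E y ↔ E x y := by
  refine ⟨fun h => mem_block.1 (h ▸ mem_block_self E y), fun h => ?_⟩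
  ext z
  rw [mem_block, mem_block]
  exact ⟨fun hz => E.trans' (E.symm' h) hz, fun hz => E.trans' h hz⟩

/-- The set of blocks of a set partition. -/
def blocks (E : Setoid X) : Finset (Finset X) := Finset.univ.image (block E)

lemma mem_blocks {E : Setoid X} {P : Finset X} : P ∈ blocks E ↔ ∃ x, block E x = P := by
  simp [blocks]

/-- The Möbius number `μ(⊥, E)` of the lattice of set partitions. -/
def moebiusBot (E : Setoid X) : ℤ := ∏ P ∈ blocks E, moebiusWeight P.card

lemma blocks_split {D : Setoid X} {T : Finset X} {a b : X} (hT : T ⊆ block D a) (ha : a ∈ T)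
    (hb : b ∈ block D a) (hbT : b ∉ T) :
    blocks (split D T) = insert T (insert (block D a \ T) ((blocks D).erase (block D a))) := by
  have h1 : ∀ x ∈ T, block (split D T) x = T := by
    intro x hx
    ext y
    rw [mem_block, split_rel]
    exact ⟨fun h => h.2.1 hx, fun h => ⟨D.trans' (D.symm' (mem_block.1 (hT hx)))
      (mem_block.1 (hT h)), iff_of_true hx h⟩⟩
  have h2 : ∀ x ∈ block D a \ T, block (split D T) x = block D a \ T := by
    intro x hx
    rw [Finset.mem_sdiff, mem_block] at hx
    ext y
    rw [mem_block, split_rel, Finset.mem_sdiff, mem_block]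
    exact ⟨fun h => ⟨D.trans' hx.1 h.1, fun hy => hx.2 (h.2.2 hy)⟩,
      fun h => ⟨D.trans' (D.symm' hx.1) h.1, iff_of_false hx.2 h.2⟩⟩
  have h3 : ∀ x ∉ block D a, block (split D T) x = block D x := by
    intro x hx
    ext y
    rw [mem_block, split_rel, mem_block]
    refine ⟨fun h => h.1, fun h => ⟨h, iff_of_false (fun hx' => hx (hT hx')) fun hy => hx ?_⟩⟩
    exact mem_block.2 (D.trans' (mem_block.1 (hT hy)) (D.symm' h))
  ext P
  rw [mem_blocks, Finset.mem_insert, Finset.mem_insert, Finset.mem_erase, mem_blocks]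
  constructor
  · rintro ⟨x, rfl⟩
    by_cases hx : x ∈ T
    · exact Or.inl (h1 x hx)
    by_cases hx' : x ∈ block D a
    · exact Or.inr (Or.inl (h2 x (Finset.mem_sdiff.2 ⟨hx', hx⟩)))
    · refine Or.inr (Or.inr ⟨?_, x, (h3 x hx').symm⟩)
      rw [h3 x hx']
      exact fun h => hx' (h ▸ mem_block_self D x)
  · rintro (rfl | rfl | ⟨hP, x, rfl⟩)
    · exact ⟨a, h1 a ha⟩
    · exact ⟨b, h2 b (Finset.mem_sdiff.2 ⟨hb, hbT⟩)⟩
    · exact ⟨x, h3 x fun hx => hP (block_eq_iff.2 (D.symm' (mem_block.1 hx)))⟩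

lemma moebiusBot_eq_mul (D : Setoid X) (a : X) :
    moebiusBot D = moebiusWeight (block D a).card
      * ∏ P ∈ (blocks D).erase (block D a), moebiusWeight P.card :=
  (Finset.mul_prod_erase _ _ (mem_blocks.2 ⟨a, rfl⟩)).symm

lemma moebiusBot_split {D : Setoid X} {T : Finset X} {a b : X} (hT : T ⊆ block D a) (ha : a ∈ T)
    (hb : b ∈ block D a) (hbT : b ∉ T) :
    moebiusBot (split D T) = moebiusWeight T.card * moebiusWeight ((block D a).card - T.card)
      * ∏ P ∈ (blocks D).erase (block D a), moebiusWeight P.card := by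
  have hdisj : ∀ P ∈ (blocks D).erase (block D a), ∀ x ∈ P, x ∉ block D a := by
    intro P hP x hx hx'
    obtain ⟨hP, y, rfl⟩ := by simpa [mem_blocks] using hP
    exact hP (block_eq_iff.2 (D.trans' (mem_block.1 hx) (D.symm' (mem_block.1 hx'))))
  rw [moebiusBot, blocks_split hT ha hb hbT, Finset.prod_insert, Finset.prod_insert,
    Finset.card_sdiff_of_subset hT, mul_assoc]
  · exact fun h => hdisj _ h b (Finset.mem_sdiff.2 ⟨hb, hbT⟩) hb
  · rw [Finset.mem_insert, not_or]
    refine ⟨fun h => ?_, fun h => hdisj _ h a ha (hT ha)⟩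
    rw [h] at ha
    exact (Finset.mem_sdiff.1 ha).2 (by rw [h]; exact ha)

lemma glue_split {D : Setoid X} {T : Finset X} {a b : X} (hT : T ⊆ block D a) (ha : a ∈ T)
    (hab : D a b) (hbT : b ∉ T) : glue (split D T) a b = D := by
  refine le_antisymm (glue_le (fun _ _ h => h.1) hab) fun x y h => ?_
  rw [glue_rel, split_rel, split_rel, split_rel, split_rel, split_rel]
  by_cases hx : x ∈ T <;> by_cases hy : y ∈ T
  · exact Or.inl ⟨h, iff_of_true hx hy⟩
  · have hxa := D.symm' (mem_block.1 (hT hx))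
    exact Or.inr (Or.inl ⟨⟨hxa, iff_of_true hx ha⟩,
      D.trans' (D.symm' hab) (D.trans' (D.symm' hxa) h), iff_of_false hbT hy⟩)
  · have hay := mem_block.1 (hT hy)
    exact Or.inr (Or.inr ⟨⟨D.trans' h (D.trans' (D.symm' hay) hab), iff_of_false hx hbT⟩,
      hay, iff_of_true ha hy⟩)
  · exact Or.inl ⟨h, iff_of_false hx hy⟩

lemma split_block_glue {E : Setoid X} {a b : X} (hab : ¬ E a b) :
    split (glue E a b) (block E a) = E := by
  ext x y
  rw [split_rel, glue_rel, mem_block, mem_block]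
  constructor
  · rintro ⟨h | ⟨h, h'⟩ | ⟨h, h'⟩, k⟩
    · exact h
    · exact absurd (E.trans' (k.1 (E.symm' h)) (E.symm' h')) hab
    · exact absurd (E.trans' (k.2 h') h) hab
  · exact fun h => ⟨Or.inl h, fun k => E.trans' k h, fun k => E.trans' k (E.symm' h)⟩

/-- A case of Weisner's theorem for the lattice of set partitions. -/
lemma sum_moebiusBot_glue_eq [Fintype (Setoid X)] {D : Setoid X} {a b : X} (hne : a ≠ b) (hab : D a b) :
    ∑ E ∈ Finset.univ.filter (fun E : Setoid X => glue E a b = D), moebiusBot E = 0 := by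
  have h1 : Finset.univ.filter (fun E : Setoid X => glue E a b = D)
      = insert D (Finset.univ.filter fun E : Setoid X => glue E a b = D ∧ ¬ E a b) := by
    ext E
    simp only [Finset.mem_filter, Finset.mem_univ, true_and, Finset.mem_insert]
    constructor
    · intro h
      by_cases hE : E a b
      · exact Or.inl (by rw [← h, glue_eq_self hE])
      · exact Or.inr ⟨h, hE⟩
    · rintro (rfl | h)
      · exact glue_eq_self hab
      · exact h.1
  set S := (block D a).erase a |>.erase b with hS
  have haS : a ∉ S := by simp [hS]
  have hbS : b ∉ S := by simp [hS]
  have hSsub : S ⊆ block D a := (Finset.erase_subset _ _).trans (Finset.erase_subset _ _)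
  have hb : b ∈ block D a := mem_block.2 hab
  have hcard : (block D a).card = S.card + 2 := by
    have e1 := Finset.card_erase_add_one (mem_block_self D a)
    have e2 := Finset.card_erase_add_one (Finset.mem_erase.2 ⟨hne.symm, hb⟩)
    rw [← hS] at e2
    omega
  have hins : ∀ T ∈ S.powerset, insert a T ⊆ block D a ∧ b ∉ insert a T ∧ a ∉ T := by
    intro T hT
    rw [Finset.mem_powerset] at hT
    refine ⟨Finset.insert_subset (mem_block_self D a) (hT.trans hSsub), ?_, fun h => haS (hT h)⟩
    rw [Finset.mem_insert, not_or]
    exact ⟨hne.symm, fun h => hbS (hT h)⟩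
  have h2 : ∑ E ∈ Finset.univ.filter (fun E : Setoid X => glue E a b = D ∧ ¬ E a b), moebiusBot E
      = ∑ T ∈ S.powerset, moebiusBot (split D (insert a T)) := by
    refine Finset.sum_bij' (fun E _ => (block E a).erase a) (fun T _ => split D (insert a T))
      ?_ ?_ ?_ ?_ ?_
    · intro E hE
      obtain ⟨-, rfl, hnot⟩ := Finset.mem_filter.1 hE
      rw [Finset.mem_powerset]
      intro x hx
      obtain ⟨hxa, hx⟩ := Finset.mem_erase.1 hx
      rw [mem_block] at hx
      refine Finset.mem_erase.2 ⟨?_, Finset.mem_erase.2 ⟨hxa, mem_block.2 (le_glue E a b hx)⟩⟩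
      rintro rfl
      exact hnot hx
    · intro T hT
      obtain ⟨i1, i2, -⟩ := hins T hT
      rw [Finset.mem_filter]
      exact ⟨Finset.mem_univ _, glue_split i1 (Finset.mem_insert_self a T) hab i2,
        fun h => i2 (h.2.1 (Finset.mem_insert_self a T))⟩
    · intro E hE
      obtain ⟨-, rfl, hnot⟩ := Finset.mem_filter.1 hE
      rw [Finset.insert_erase (mem_block_self E a), split_block_glue hnot]
    · intro T hT
      obtain ⟨i1, i2, i3⟩ := hins T hT
      have : block (split D (insert a T)) a = insert a T := by
        ext x
        rw [mem_block, split_rel]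
        exact ⟨fun h => h.2.1 (Finset.mem_insert_self a T), fun h => ⟨mem_block.1 (i1 h),
          iff_of_true (Finset.mem_insert_self a T) h⟩⟩
      rw [this, Finset.erase_insert i3]
    · intro E hE
      obtain ⟨-, rfl, hnot⟩ := Finset.mem_filter.1 hE
      rw [Finset.insert_erase (mem_block_self E a), split_block_glue hnot]
  have h3 : ∑ T ∈ S.powerset, moebiusBot (split D (insert a T))
      = -moebiusWeight (S.card + 2)
        * ∏ P ∈ (blocks D).erase (block D a), moebiusWeight P.card := by
    rw [Finset.sum_powerset, ← sum_choose_mul_moebiusWeight, Finset.sum_mul]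
    refine Finset.sum_congr rfl fun j hj => ?_
    have hj : j ≤ S.card := Nat.lt_succ_iff.1 (Finset.mem_range.1 hj)
    rw [← Finset.card_powersetCard, ← nsmul_eq_mul, ← Finset.sum_const, Finset.sum_mul]
    refine Finset.sum_congr rfl fun T hT => ?_
    obtain ⟨hTS, rfl⟩ := Finset.mem_powersetCard.1 hT
    obtain ⟨i1, i2, i3⟩ := hins T (Finset.mem_powerset.2 hTS)
    rw [moebiusBot_split i1 (Finset.mem_insert_self a T) hb i2, Finset.card_insert_of_notMem i3,
      hcard, show S.card + 2 - (T.card + 1) = S.card - T.card + 1 by omega]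
  rw [h1, Finset.sum_insert (by simp [hab]), h2, h3, moebiusBot_eq_mul D a, hcard]
  ring

lemma sum_moebiusBot_smul_glue [Fintype (Setoid X)] {M : Type*} [AddCommGroup M] (φ : Setoid X → M) {a b : X}
    (hne : a ≠ b) : ∑ E : Setoid X, moebiusBot E • φ (glue E a b) = 0 := by
  rw [← Finset.sum_fiberwise Finset.univ (fun E : Setoid X => glue E a b)]
  refine Finset.sum_eq_zero fun D _ => ?_
  have h : ∀ E ∈ Finset.univ.filter (fun E : Setoid X => glue E a b = D),
      moebiusBot E • φ (glue E a b) = moebiusBot E • φ D := by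
    intro E hE
    rw [(Finset.mem_filter.1 hE).2]
  rw [Finset.sum_congr rfl h, ← Finset.sum_smul]
  by_cases hab : D a b
  · rw [sum_moebiusBot_glue_eq hne hab, zero_smul]
  · rw [Finset.filter_false_of_mem, Finset.sum_empty, zero_smul]
    rintro E - rfl
    exact hab (glue_rel_left_right E a b)

/-- The Möbius number as a product over multiplicities, as in the definition of `mob`. -/
lemma prod_factorial_pow_eq {Q : Type*} [Fintype Q] (m : Q → ℕ) (hm : ∀ c, 1 ≤ m c) :
    (-1 : ℤ) ^ ((∑ c, m c) - Fintype.card Q)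
        * ∏ i ∈ Finset.Icc 1 ((∑ c, m c) - 1),
            (Nat.factorial i : ℤ) ^ Nat.card {c : Q // m c = i + 1}
      = ∏ c, moebiusWeight (m c) := by
  have hsign : (∑ c, m c) - Fintype.card Q = ∑ c, (m c - 1) := by
    rw [Finset.sum_tsub_distrib _ fun c _ => hm c]
    simp
  simp only [moebiusWeight]
  rw [Finset.prod_mul_distrib, Finset.prod_pow_eq_pow_sum, hsign]
  congr 1
  have hle : ∀ c, m c ≤ ∑ c, m c := fun c =>
    Finset.single_le_sum (f := m) (fun _ _ => Nat.zero_le _) (Finset.mem_univ c)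
  have hmaps : ∀ c ∈ (Finset.univ : Finset Q), m c - 1 ∈ Finset.range ((∑ c, m c) - 1 + 1) := by
    intro c _
    have := hle c
    rw [Finset.mem_range]
    omega
  rw [← Finset.prod_fiberwise_of_maps_to' hmaps fun i => (Nat.factorial i : ℤ)]
  have hrange : Finset.range ((∑ c, m c) - 1 + 1)
      = insert 0 (Finset.Icc 1 ((∑ c, m c) - 1)) := by
    ext i
    simp only [Finset.mem_range, Finset.mem_insert, Finset.mem_Icc]
    omega
  rw [hrange, Finset.prod_insert (by simp)]
  simp only [Finset.prod_const]
  rw [Nat.factorial_zero, Nat.cast_one, one_pow, one_mul]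
  refine Finset.prod_congr rfl fun i hi => ?_
  congr 1
  rw [Nat.card_eq_fintype_card, Fintype.card_subtype]
  congr 1
  ext c
  have hc := hm c
  rw [Finset.mem_Icc] at hi
  simp only [Finset.mem_filter, Finset.mem_univ, true_and]
  omega

variable {n : ℕ}

lemma le_comap_mk (A : Setoid (Fin n)) (E : Setoid (Quotient A)) :
    A ≤ Setoid.comap (Quotient.mk A) E := by
  intro x y h
  rw [Setoid.comap_rel, Quotient.sound h]

lemma mcount_comap_mk (A : Setoid (Fin n)) (E : Setoid (Quotient A))
    (c : Quotient (Setoid.comap (Quotient.mk A) E)) :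
    mcount n A (Setoid.comap (Quotient.mk A) E) c
      = (block E (Quotient.mk A c.out)).card := by
  rw [mcount, Nat.card_eq_fintype_card, Fintype.card_subtype]
  congr 1
  ext x
  have h : (Setoid.comap (Quotient.mk A) E).r x.out c.out
      ↔ E (Quotient.mk A x.out) (Quotient.mk A c.out) := Iff.rfl
  rw [mem_block, Finset.mem_filter, h, Quotient.out_eq]
  exact ⟨fun h => E.symm' h.2, fun h => ⟨Finset.mem_univ _, E.symm' h⟩⟩

lemma mob_comap_mk (A : Setoid (Fin n)) (E : Setoid (Quotient A)) :
    mob n A (Setoid.comap (Quotient.mk A) E) = moebiusBot E := by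
  set C := Setoid.comap (Quotient.mk A) E with hC
  have hinj : Function.Injective fun c : Quotient C => block E (Quotient.mk A c.out) := by
    intro c d h
    have h' : C c.out d.out := block_eq_iff (E := E).1 h
    rw [← Quotient.out_eq c, ← Quotient.out_eq d]
    exact Quotient.sound h'
  have himage : blocks E
      = Finset.univ.image fun c : Quotient C => block E (Quotient.mk A c.out) := by
    ext P
    simp only [mem_blocks, Finset.mem_image, Finset.mem_univ, true_and]
    constructor
    · rintro ⟨x, rfl⟩
      refine ⟨Quotient.mk C x.out, block_eq_iff.2 ?_⟩
      have h : C (Quotient.mk C x.out).out x.out := Quotient.mk_out x.out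
      rw [hC, Setoid.comap_rel, Quotient.out_eq x] at h
      exact h
    · rintro ⟨c, rfl⟩
      exact ⟨_, rfl⟩
  have hprod : ∀ f : Finset (Quotient A) → ℤ,
      ∏ P ∈ blocks E, f P = ∏ c : Quotient C, f (block E (Quotient.mk A c.out)) := by
    intro f
    rw [himage, Finset.prod_image fun _ _ _ _ h => hinj h]
  have hsum : ∑ c : Quotient C, mcount n A C c = nblocks n A := by
    rw [nblocks, Nat.card_eq_fintype_card, ← Finset.card_univ,
      Finset.card_eq_sum_card_fiberwise (f := fun x : Quotient A => Quotient.mk C x.out)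
        (t := Finset.univ) (by simp)]
    refine Finset.sum_congr rfl fun c _ => ?_
    rw [mcount, Nat.card_eq_fintype_card, Fintype.card_subtype]
    congr 1
    ext x
    simp only [Finset.mem_filter, Finset.mem_univ, true_and]
    rw [Quotient.mk_eq_iff_out]
  have hpos : ∀ c : Quotient C, 1 ≤ mcount n A C c := by
    intro c
    rw [mcount_comap_mk]
    exact Finset.card_pos.2 ⟨_, mem_block_self _ _⟩
  rw [mob, if_pos (le_comap_mk A E), moebiusBot, hprod fun P => moebiusWeight P.card, ← hsum,
    nblocks, Nat.card_eq_fintype_card, prod_factorial_pow_eq _ hpos]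
  exact Finset.prod_congr rfl fun c _ => by rw [mcount_comap_mk]

/-- A case of Weisner's theorem for the interval above `A` in the lattice of set partitions. -/
lemma sum_mob_smul_glue {M : Type*} [AddCommGroup M] (φ : Setoid (Fin n) → M)
    {A : Setoid (Fin n)} {a b : Fin n} (hab : ¬ A a b) :
    ∑ C ∈ Finset.univ.filter (fun C : Setoid (Fin n) => A ≤ C),
      mob n A C • φ (glue C a b) = 0 := by
  have hne : Quotient.mk A a ≠ Quotient.mk A b := fun h => hab (Quotient.exact h)
  have hfin : Finite (Setoid (Quotient A)) :=
    Finite.of_equiv _ (Setoid.correspondence A).toEquiv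
  have := Fintype.ofFinite (Setoid (Quotient A))
  rw [← sum_moebiusBot_smul_glue (fun E => φ (Setoid.comap (Quotient.mk A) E)) hne]
  symm
  refine Finset.sum_bij (fun E _ => Setoid.comap (Quotient.mk A) E) ?_ ?_ ?_ ?_
  · exact fun E _ => Finset.mem_filter.2 ⟨Finset.mem_univ _, le_comap_mk A E⟩
  · intro E _ E' _ h
    ext x y
    induction x using Quotient.inductionOn with | h x => ?_
    induction y using Quotient.inductionOn with | h y => ?_
    exact Setoid.ext_iff.1 h x y
  · intro C hC
    exact ⟨Setoid.correspondence A ⟨C, (Finset.mem_filter.1 hC).2⟩, Finset.mem_univ _,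
      Setoid.ext fun x y => Iff.rfl⟩
  · intro E _
    rw [mob_comap_mk]
    rfl

end Moebius

section Action

variable {𝕜 : Type} [Field 𝕜] {n : ℕ} {q : 𝕜}

lemma eab_mul_ebar_of_rel (hq : q ≠ 0) {i j : Fin n} (hij : i ≠ j) {A : Setoid (Fin n)}
    (h : A i j) : eab 𝕜 n q i j * ebar 𝕜 n q A = ebar 𝕜 n q A := by
  rw [ebar, Finset.mul_sum]
  refine Finset.sum_congr rfl fun C hC => ?_
  rw [mul_smul_comm, eab_mul_eSet hq hij ((Finset.mem_filter.1 hC).2 h)]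

lemma eab_mul_ebar_of_not_rel (hq : q ≠ 0) {i j : Fin n} {A : Setoid (Fin n)}
    (h : ¬ A i j) : eab 𝕜 n q i j * ebar 𝕜 n q A = 0 := by
  have hij : i ≠ j := by
    rintro rfl
    exact h (A.refl' i)
  rw [ebar, Finset.mul_sum, ← sum_mob_smul_glue (eSet 𝕜 n q) h]
  refine Finset.sum_congr rfl fun C _ => ?_
  rw [mul_smul_comm, eab_mul_eSet_eq_eSet_glue hq hij]

end Action

end BT

open BT in
/-- in the bt-algebra `E_n(q)` (0-based indices): if `a ∼_A (a+1)` then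
`g_a² ē(A) = (q + (q−1) g_a) ē(A)`, and if `a ≁_A (a+1)` then `g_a² ē(A) = q ē(A)`. -/
theorem statement12 (𝕜 : Type) [Field 𝕜] (n : ℕ) (q : 𝕜) (hq0 : q ≠ 0) (hq1 : q ≠ 1) :
    ∀ (A : Setoid (Fin n)) (a : ℕ) (h : a + 1 < n),
      (A.r ⟨a, by omega⟩ ⟨a + 1, h⟩ →
        g 𝕜 n q a h ^ 2 * ebar 𝕜 n q A
          = (algebraMap 𝕜 (B 𝕜 n q) q + (q - 1) • g 𝕜 n q a h) * ebar 𝕜 n q A)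
      ∧ (¬ A.r ⟨a, by omega⟩ ⟨a + 1, h⟩ →
        g 𝕜 n q a h ^ 2 * ebar 𝕜 n q A = q • ebar 𝕜 n q A) := by
  intro A a h
  have hne : (⟨a, by omega⟩ : Fin n) ≠ ⟨a + 1, h⟩ := by simp
  constructor <;> intro hA
  · have he := eab_mul_ebar_of_rel (𝕜 := 𝕜) hq0 hne hA
    rw [eab_succ] at he
    rw [g_sq, ← g_mul_e, add_mul, add_mul, smul_mul_assoc, smul_mul_assoc, mul_assoc, he]
  · have he := eab_mul_ebar_of_not_rel (𝕜 := 𝕜) hq0 hA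
    rw [eab_succ] at he
    rw [g_sq, ← g_mul_e, add_mul, smul_mul_assoc, mul_assoc, he, mul_zero, smul_zero, add_zero,
      Algebra.smul_def]

end
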